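/- arXiv:1810.07257 — 5 statements merged into one kernel-verified Lean document; each statement's English description precedes it below -/
import Mathlib

section
/- Let α ∈ (0, π) and let c : [0,1] → ℝ² be a regular curve of class C² parametrized proportional to arc length, with unit tangent τ = ∂_σ c / L[c]. Suppose τ(0) = (cos α, sin α) and τ(1) = (cos α, −sin α). Then 1/L[c] ≤ (1/(√2 sin α)) · sup_{σ ∈ [0,1]} |κ[c](σ)|, where κ[c] is the scalar curvature of c. -/
open scoped RealInnerProductSpace

/-- The counterclockwise rotation of `ℝ²` by `π/2`. -/
noncomputable def rot (v : EuclideanSpace ℝ (Fin 2)) : EuclideanSpace ℝ (Fin 2) :=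
  (EuclideanSpace.equiv (Fin 2) ℝ).symm ![-(v 1), v 0]

/-- The vector `(a, b) ∈ ℝ²`. -/
noncomputable def vec2 (a b : ℝ) : EuclideanSpace ℝ (Fin 2) :=
  (EuclideanSpace.equiv (Fin 2) ℝ).symm ![a, b]

theorem inner_sq_add_inner_rot_sq (u v : EuclideanSpace ℝ (Fin 2)) :
    ⟪u, v⟫ ^ 2 + ⟪u, rot v⟫ ^ 2 = ‖u‖ ^ 2 * ‖v‖ ^ 2 := by
  simp only [EuclideanSpace.real_norm_sq_eq, PiLp.inner_apply, Fin.sum_univ_two, rot]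
  simp
  ring

theorem rot_smul (a : ℝ) (v : EuclideanSpace ℝ (Fin 2)) : rot (a • v) = a • rot v := by
  ext i
  fin_cases i <;> simp [rot]

/-- A vector-valued function of constant norm on `[0, 1]` is orthogonal to its derivative. -/
theorem inner_deriv_eq_zero_of_norm_eq {E : Type*} [NormedAddCommGroup E] [InnerProductSpace ℝ E]
    {f : ℝ → E} {f' : E} {r t : ℝ} (ht : t ∈ Set.Icc (0 : ℝ) 1)
    (hf : HasDerivWithinAt f f' (Set.Icc 0 1) t)
    (hr : ∀ s ∈ Set.Icc (0 : ℝ) 1, ‖f s‖ = r) : ⟪f', f t⟫ = 0 := by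
  have h₁ : HasDerivWithinAt (fun s => ⟪f s, f s⟫) (⟪f t, f'⟫ + ⟪f', f t⟫) (Set.Icc 0 1) t :=
    hf.inner ℝ hf
  have h₂ : HasDerivWithinAt (fun s => ⟪f s, f s⟫) 0 (Set.Icc 0 1) t :=
    (hasDerivWithinAt_const t _ (r ^ 2)).congr_of_mem
      (fun s hs => by rw [real_inner_self_eq_norm_sq, hr s hs]) ht
  have h := (uniqueDiffOn_Icc_zero_one t ht).eq_deriv _ h₁ h₂
  rw [real_inner_comm] at h
  linarith

/-- Let `α ∈ (0, π)` and let `c : [0,1] → ℝ²` be a regular `C²` curve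
parametrized proportional to arc length (speed `L = L[c] > 0`), with unit tangent
`τ = c'/L` satisfying `τ(0) = (cos α, sin α)` and `τ(1) = (cos α, −sin α)`.
Then `1/L[c] ≤ (1/(√2 sin α)) · sup_{σ ∈ [0,1]} |κ[c](σ)|`, where
`κ[c](σ) = ⟨c''(σ), n(σ)⟩/L²` is the scalar curvature (with `n = R τ`). -/
theorem one_div_length_le_curvature_sup
    (α : ℝ) (hα : α ∈ Set.Ioo 0 Real.pi)
    (L : ℝ) (hL : 0 < L)
    (c c' c'' : ℝ → EuclideanSpace ℝ (Fin 2))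
    (hc' : ∀ σ ∈ Set.Icc (0:ℝ) 1, HasDerivWithinAt c (c' σ) (Set.Icc 0 1) σ)
    (hc'' : ∀ σ ∈ Set.Icc (0:ℝ) 1, HasDerivWithinAt c' (c'' σ) (Set.Icc 0 1) σ)
    (hc''cont : ContinuousOn c'' (Set.Icc 0 1))
    (hspeed : ∀ σ ∈ Set.Icc (0:ℝ) 1, ‖c' σ‖ = L)
    (hτ0 : c' 0 = L • vec2 (Real.cos α) (Real.sin α))
    (hτ1 : c' 1 = L • vec2 (Real.cos α) (-Real.sin α))
    (κ : ℝ → ℝ)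
    (hκ : ∀ σ ∈ Set.Icc (0:ℝ) 1, κ σ = ⟪c'' σ, rot ((1/L) • c' σ)⟫ / L ^ 2) :
    1 / L ≤ (1 / (Real.sqrt 2 * Real.sin α)) * sSup ((fun σ => |κ σ|) '' Set.Icc 0 1) := by
  obtain ⟨hα0, hαπ⟩ := hα
  have hsin : 0 < Real.sin α := Real.sin_pos_of_pos_of_lt_pi hα0 hαπ
  have hcurv : ∀ σ ∈ Set.Icc (0 : ℝ) 1, |κ σ| = ‖c'' σ‖ / L ^ 2 := by
    intro σ hσ
    have horth := inner_deriv_eq_zero_of_norm_eq hσ (hc'' σ hσ) hspeed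
    have hsq := inner_sq_add_inner_rot_sq (c'' σ) (c' σ)
    rw [horth, hspeed σ hσ] at hsq
    have habs : |⟪c'' σ, rot (c' σ)⟫| = ‖c'' σ‖ * L := by
      rw [← abs_of_nonneg (mul_nonneg (norm_nonneg (c'' σ)) hL.le)]
      exact (sq_eq_sq_iff_abs_eq_abs _ _).1 (by linarith)
    rw [hκ σ hσ, rot_smul, real_inner_smul_right, abs_div, abs_mul, habs,
      abs_of_pos (one_div_pos.2 hL), abs_of_pos (pow_pos hL 2)]
    field_simp
  set K := sSup ((fun σ => |κ σ|) '' Set.Icc 0 1)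
  have hbdd : BddAbove ((fun σ => |κ σ|) '' Set.Icc (0 : ℝ) 1) := by
    rw [Set.image_congr hcurv]
    exact (isCompact_Icc.image_of_continuousOn (hc''cont.norm.div_const _)).bddAbove
  have hle : ∀ σ ∈ Set.Icc (0 : ℝ) 1, ‖c'' σ‖ ≤ K * L ^ 2 := fun σ hσ => by
    have h : |κ σ| ≤ K := le_csSup hbdd (Set.mem_image_of_mem _ hσ)
    rwa [hcurv σ hσ, div_le_iff₀ (pow_pos hL 2)] at h
  have hmvt := (convex_Icc (0 : ℝ) 1).norm_image_sub_le_of_norm_hasDerivWithin_le hc'' hle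
    (Set.left_mem_Icc.2 zero_le_one) (Set.right_mem_Icc.2 zero_le_one)
  have hchord : L * (2 * Real.sin α) ≤ ‖c' 1 - c' 0‖ := by
    have h := PiLp.norm_apply_le (c' 1 - c' 0) 1
    have h1 : (c' 1 - c' 0) 1 = -(L * (2 * Real.sin α)) := by
      rw [hτ0, hτ1]
      simp [vec2]
      ring
    rwa [h1, norm_neg, Real.norm_of_nonneg (by positivity)] at h
  have hKL : 2 * Real.sin α ≤ K * L := by
    rw [sub_zero, norm_one, mul_one] at hmvt
    exact le_of_mul_le_mul_left (by linarith) hL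
  have hsqrt : Real.sqrt 2 ≤ 2 := Real.sqrt_le_iff.2 (by norm_num)
  rw [one_div_mul_eq_div, div_le_div_iff₀ hL (by positivity), one_mul]
  exact (mul_le_mul_of_nonneg_right hsqrt hsin.le).trans hKL
end

section
/- Fix T₀ > 0, p ∈ (1, ∞), μ ∈ (1/p, 1], s ∈ (0, 1) with s > 1 − μ + 1/p, a real Banach space E, and α with 0 < α < s − (1 − μ) − 1/p. Then there exists a constant C = C(T₀, p, μ, s, α) such that for every T ∈ (0, T₀] and every continuous function u : [0, T] → E with finite weighted Sobolev–Slobodetskii norm ‖u‖_{W^s_{p,μ}((0,T);E)}, one has ‖u‖_{C^α([0,T];E)} ≤ C ( ‖u‖_{W^s_{p,μ}((0,T);E)} + ‖u(0)‖_E ), where ‖u‖_{C^α([0,T];E)} := sup_{t∈[0,T]} ‖u(t)‖_E + sup_{t≠τ ∈ [0,T]} ‖u(t) − u(τ)‖_E / |t − τ|^α. In particular, the constant C does not depend on T ∈ (0, T₀]. -/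
open scoped ENNReal

/-- The weighted Lebesgue norm `‖u‖_{L_{p,μ}((0,T);E)} = (∫₀ᵀ t^{(1−μ)p} ‖u(t)‖^p dt)^{1/p}`,
valued in `ℝ≥0∞` so that finiteness can be expressed. -/
noncomputable def wLebNorm (p μ T : ℝ) {E : Type*} [NormedAddCommGroup E] (u : ℝ → E) : ℝ≥0∞ :=
  (∫⁻ t in Set.Ioo (0:ℝ) T, ENNReal.ofReal (t ^ ((1 - μ) * p) * ‖u t‖ ^ p)) ^ (1 / p)

/-- The weighted Sobolev–Slobodetskii seminorm
`[u]_{W^s_{p,μ}((0,T);E)} = (∫₀ᵀ ∫₀ᵗ τ^{(1−μ)p} ‖u(t) − u(τ)‖^p / |t − τ|^{1+sp} dτ dt)^{1/p}`. -/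
noncomputable def wSlobSeminorm (p μ s T : ℝ) {E : Type*} [NormedAddCommGroup E]
    (u : ℝ → E) : ℝ≥0∞ :=
  (∫⁻ t in Set.Ioo (0:ℝ) T, ∫⁻ τ in Set.Ioo (0:ℝ) t,
      ENNReal.ofReal (τ ^ ((1 - μ) * p) * ‖u t - u τ‖ ^ p / |t - τ| ^ (1 + s * p))) ^ (1 / p)

/-- The weighted Sobolev–Slobodetskii norm `‖u‖_{W^s_{p,μ}} = ‖u‖_{L_{p,μ}} + [u]_{W^s_{p,μ}}`. -/
noncomputable def wSlobNorm (p μ s T : ℝ) {E : Type*} [NormedAddCommGroup E]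
    (u : ℝ → E) : ℝ≥0∞ :=
  wLebNorm p μ T u + wSlobSeminorm p μ s T u

section WeightedEmbedding

open MeasureTheory Set Filter Topology

section Averages

variable {α E : Type*} {m : MeasurableSpace α} [NormedAddCommGroup E] [NormedSpace ℝ E]

/-- Jensen's inequality for the `p`-th power of the norm of an average. -/
theorem enorm_average_rpow_le {p : ℝ} (hp : 1 ≤ p) (ν : Measure α) [IsFiniteMeasure ν]
    [NeZero ν] {f : α → E} (hf : AEStronglyMeasurable f ν) :
    ‖⨍ x, f x ∂ν‖ₑ ^ p ≤ ⨍⁻ x, ‖f x‖ₑ ^ p ∂ν := by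
  have hp0 : 0 < p := by linarith
  set ν' : Measure α := (ν univ)⁻¹ • ν with hν'
  have hfν : AEStronglyMeasurable f ν' := hf.smul_measure _
  have h1 : ‖⨍ x, f x ∂ν‖ₑ ≤ eLpNorm f 1 ν' := by
    rw [eLpNorm_one_eq_lintegral_enorm]
    exact enorm_integral_le_lintegral_enorm f
  have h2 : eLpNorm f 1 ν' ≤ eLpNorm f (ENNReal.ofReal p) ν' :=
    eLpNorm_le_eLpNorm_of_exponent_le (by simpa using hp) hfν
  rw [eLpNorm_eq_lintegral_rpow_enorm_toReal (p := ENNReal.ofReal p)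
    (by simpa using hp0) ENNReal.ofReal_ne_top, ENNReal.toReal_ofReal hp0.le] at h2
  calc ‖⨍ x, f x ∂ν‖ₑ ^ p ≤ ((∫⁻ x, ‖f x‖ₑ ^ p ∂ν') ^ (1 / p)) ^ p :=
        ENNReal.rpow_le_rpow (h1.trans h2) hp0.le
    _ = ⨍⁻ x, ‖f x‖ₑ ^ p ∂ν := by
        rw [← ENNReal.rpow_mul, one_div_mul_cancel hp0.ne', ENNReal.rpow_one]
        rfl

variable [CompleteSpace E]

theorem average_sub_const (ν : Measure α) [IsFiniteMeasure ν] [NeZero ν] {f : α → E}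
    (hf : Integrable f ν) (c : E) : ⨍ x, (f x - c) ∂ν = (⨍ x, f x ∂ν) - c := by
  have h := integral_sub hf.to_average (integrable_const c)
  rw [average, h]
  congr 1
  exact average_const ν c

theorem average_const_sub (ν : Measure α) [IsFiniteMeasure ν] [NeZero ν] {f : α → E}
    (hf : Integrable f ν) (c : E) : ⨍ x, (c - f x) ∂ν = c - ⨍ x, f x ∂ν := by
  have h := integral_sub (integrable_const c) hf.to_average
  rw [average, h]
  congr 1
  exact average_const ν c

/-- The distance of two averages is controlled by the average of the distances. -/
theorem enorm_average_sub_average_rpow_le {p : ℝ} (hp : 1 ≤ p) (ν ρ : Measure α)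
    [IsFiniteMeasure ν] [NeZero ν] [IsFiniteMeasure ρ] [NeZero ρ] {f : α → E}
    (hν : Integrable f ν) (hρ : Integrable f ρ) :
    ‖(⨍ x, f x ∂ν) - ⨍ y, f y ∂ρ‖ₑ ^ p ≤ ⨍⁻ x, ⨍⁻ y, ‖f x - f y‖ₑ ^ p ∂ρ ∂ν := by
  rw [← average_sub_const ν hν]
  refine (enorm_average_rpow_le hp ν
    (hν.aestronglyMeasurable.sub aestronglyMeasurable_const)).trans ?_
  refine lintegral_mono fun x => ?_
  rw [Pi.sub_apply, ← average_const_sub ρ hρ]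
  exact enorm_average_rpow_le hp ρ (aestronglyMeasurable_const.sub hρ.aestronglyMeasurable)

end Averages

section Intervals

theorem neZero_restrict_Ioo {a b : ℝ} (hab : a < b) :
    NeZero ((volume : Measure ℝ).restrict (Ioo a b)) :=
  ⟨by simpa [Measure.restrict_eq_zero] using hab⟩

theorem ContinuousOn.integrableOn_Ioo_of_subset {E : Type*} [NormedAddCommGroup E]
    {u : ℝ → E} {T a b : ℝ} (hu : ContinuousOn u (Icc 0 T)) (ha : 0 ≤ a) (hb : b ≤ T) : IntegrableOn u (Ioo a b) :=
  (hu.integrableOn_Icc).mono_set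
    (Ioo_subset_Icc_self.trans (Icc_subset_Icc ha hb))

variable {E : Type*} [NormedAddCommGroup E] [NormedSpace ℝ E] [CompleteSpace E]

/-- Averages of a continuous function over intervals shrinking to a point converge to the value
at that point. -/
theorem tendsto_setAverage_Ioo {u : ℝ → E} {T x : ℝ} (hu : ContinuousOn u (Icc 0 T))
    (hx : x ∈ Icc 0 T) {a b : ℕ → ℝ} (hab : ∀ n, a n < b n) (ha : ∀ n, 0 ≤ a n)
    (hb : ∀ n, b n ≤ T) (hax : Tendsto a atTop (𝓝 x)) (hbx : Tendsto b atTop (𝓝 x)) :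
    Tendsto (fun n => ⨍ t in Ioo (a n) (b n), u t) atTop (𝓝 (u x)) := by
  rw [Metric.nhds_basis_closedBall.tendsto_right_iff]
  intro ε hε
  obtain ⟨δ, hδ, h⟩ := Metric.continuousOn_iff.1 hu x hx ε hε
  filter_upwards [hax (Metric.ball_mem_nhds x hδ), hbx (Metric.ball_mem_nhds x hδ)] with n h1 h2
  refine (convex_closedBall (u x) ε).set_average_mem Metric.isClosed_closedBall ?_ ?_ ?_
    (hu.integrableOn_Ioo_of_subset (ha n) (hb n))
  · simpa using hab n
  · simp
  · refine (ae_restrict_iff' measurableSet_Ioo).2 (ae_of_all _ fun t ht => ?_)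
    refine (h t ⟨(ha n).trans ht.1.le, ht.2.le.trans (hb n)⟩ ?_).le
    simp only [mem_preimage, Metric.mem_ball, Real.dist_eq, abs_lt] at h1 h2 ⊢
    constructor <;> linarith [ht.1, ht.2]

theorem slobodetskii_kernel_bound {p μ s r t τ y : ℝ} (hp : 0 < p) (hμ : μ ≤ 1) (hs : 0 < s)
    (hr : 0 < r) (hτ : r / 4 ≤ τ) (htτ : τ < t) (htr : t - τ ≤ r) (hy : 0 ≤ y) :
    y ≤ r ^ (1 + s * p) * (r / 4) ^ (-((1 - μ) * p)) *
      (τ ^ ((1 - μ) * p) * y / |t - τ| ^ (1 + s * p)) := by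
  have h0 : 0 ≤ (1 - μ) * p := mul_nonneg (by linarith) hp.le
  have h1 : 0 < t - τ := by linarith
  have hr4 : 0 < r / 4 := by linarith
  rw [abs_of_pos h1]
  have e1 : (t - τ) ^ (1 + s * p) ≤ r ^ (1 + s * p) := by gcongr
  have e2 : (r / 4) ^ ((1 - μ) * p) ≤ τ ^ ((1 - μ) * p) := by gcongr
  have p1 : 0 < (t - τ) ^ (1 + s * p) := by positivity
  have p2 : 0 < (r / 4) ^ ((1 - μ) * p) := by positivity
  rw [Real.rpow_neg hr4.le]
  have e3 : 1 ≤ r ^ (1 + s * p) / (t - τ) ^ (1 + s * p) := (one_le_div p1).2 e1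
  have e4 : 1 ≤ τ ^ ((1 - μ) * p) / (r / 4) ^ ((1 - μ) * p) := (one_le_div p2).2 e2
  calc y = 1 * 1 * y := by ring
    _ ≤ (r ^ (1 + s * p) / (t - τ) ^ (1 + s * p)) *
        (τ ^ ((1 - μ) * p) / (r / 4) ^ ((1 - μ) * p)) * y := by gcongr
    _ = _ := by ring

theorem rpow_scaling {p μ s r : ℝ} (hp : 0 < p) (hr : 0 < r) :
    (4 / r * (4 / r * (r ^ (1 + s * p) * (r / 4) ^ (-((1 - μ) * p))))) ^ (1 / p) =
      (16 * 4 ^ ((1 - μ) * p)) ^ (1 / p) * r ^ (s - (1 - μ) - 1 / p) := by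
  have h : 4 / r * (4 / r * (r ^ (1 + s * p) * (r / 4) ^ (-((1 - μ) * p)))) =
      16 * 4 ^ ((1 - μ) * p) * (r ^ (s - (1 - μ) - 1 / p)) ^ p := by
    have e : (s - (1 - μ) - 1 / p) * p = (1 + s * p) + (-((1 - μ) * p)) - 2 := by
      field_simp
      ring
    rw [← Real.rpow_mul hr.le, e, Real.rpow_sub hr,
      Real.rpow_add hr (1 + s * p), Real.div_rpow hr.le (by norm_num), Real.rpow_neg (by norm_num : (0 : ℝ) ≤ 4),
      Real.rpow_two]
    generalize r ^ (1 + s * p) = y, r ^ (-((1 - μ) * p)) = z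
    field_simp
    ring
  rw [h, Real.mul_rpow (by positivity) (by positivity), one_div,
    Real.rpow_rpow_inv (by positivity) hp.ne']

/-- Averages over two adjacent intervals of length comparable to `r`, at distance at least
comparable to `r` from the origin, differ by at most a multiple of `r ^ (s - (1 - μ) - 1 / p)`. -/
theorem dist_setAverage_adjacent_le {p μ s T r a b c : ℝ} {u : ℝ → E} (hp : 1 < p) (hμ : μ ≤ 1)
    (hs : 0 < s) (hu : ContinuousOn u (Icc 0 T)) (hfin : wSlobSeminorm p μ s T u ≠ ⊤)
    (hr : 0 < r) (ha : r / 4 ≤ a) (hab : r / 4 ≤ b - a) (hbc : r / 4 ≤ c - b)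
    (hac : c - a ≤ r) (hc : c ≤ T) :
    dist (⨍ t in Ioo b c, u t) (⨍ t in Ioo a b, u t) ≤
      (16 * 4 ^ ((1 - μ) * p)) ^ (1 / p) * r ^ (s - (1 - μ) - 1 / p) *
        (wSlobSeminorm p μ s T u).toReal := by
  have hp0 : 0 < p := by linarith
  have hr4 : 0 < r / 4 := by linarith
  have := neZero_restrict_Ioo (show a < b by linarith)
  have := neZero_restrict_Ioo (show b < c by linarith)
  have hvol : ∀ {x y : ℝ}, r / 4 ≤ y - x → ∀ z : ℝ≥0∞,
      z / volume (Ioo x y) ≤ ENNReal.ofReal (4 / r) * z := by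
    intro x y hxy z
    rw [Real.volume_Ioo, mul_comm, div_eq_mul_inv,
      show (4 / r) = (r / 4)⁻¹ from (inv_div r 4).symm, ENNReal.ofReal_inv_of_pos hr4]
    gcongr
  set M : ℝ := r ^ (1 + s * p) * (r / 4) ^ (-((1 - μ) * p)) with hM
  have hM0 : 0 ≤ M := by positivity
  set k : ℝ → ℝ → ℝ≥0∞ := fun t τ =>
    ENNReal.ofReal (τ ^ ((1 - μ) * p) * ‖u t - u τ‖ ^ p / |t - τ| ^ (1 + s * p)) with hk
  have hker : ∀ t ∈ Ioo b c, ∀ τ ∈ Ioo a b, ‖u t - u τ‖ₑ ^ p ≤ ENNReal.ofReal M * k t τ := by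
    intro t ht τ hτ
    rw [← ofReal_norm, ENNReal.ofReal_rpow_of_nonneg (norm_nonneg _) hp0.le, hk,
      ← ENNReal.ofReal_mul hM0]
    exact ENNReal.ofReal_le_ofReal (slobodetskii_kernel_bound hp0 hμ hs hr
      (ha.trans hτ.1.le) (hτ.2.trans ht.1) (by linarith [ht.2, hτ.1]) (by positivity))
  have hinner : ∀ t ∈ Ioo b c, ⨍⁻ τ in Ioo a b, ‖u t - u τ‖ₑ ^ p ∂volume ≤
      ENNReal.ofReal (4 / r) * (ENNReal.ofReal M * ∫⁻ τ in Ioo 0 t, k t τ) := by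
    intro t ht
    rw [setLAverage_eq]
    refine (hvol hab _).trans ?_
    gcongr
    rw [← lintegral_const_mul' _ _ ENNReal.ofReal_ne_top]
    exact (setLIntegral_mono' measurableSet_Ioo (hker t ht)).trans
      (lintegral_mono_set (Ioo_subset_Ioo (by linarith) ht.1.le))
  have hmain : ‖(⨍ t in Ioo b c, u t) - ⨍ t in Ioo a b, u t‖ₑ ^ p ≤
      ENNReal.ofReal (4 / r * (4 / r * M)) * ∫⁻ t in Ioo 0 T, ∫⁻ τ in Ioo 0 t, k t τ := by
    refine (enorm_average_sub_average_rpow_le hp.le _ _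
      (hu.integrableOn_Ioo_of_subset (by linarith) hc)
      (hu.integrableOn_Ioo_of_subset (by linarith) (by linarith))).trans ?_
    rw [setLAverage_eq]
    refine (hvol hbc _).trans ?_
    rw [ENNReal.ofReal_mul (by positivity), ENNReal.ofReal_mul (by positivity), mul_assoc]
    gcongr
    rw [← lintegral_const_mul' _ _ (ENNReal.mul_ne_top ENNReal.ofReal_ne_top
      ENNReal.ofReal_ne_top)]
    refine (setLIntegral_mono' measurableSet_Ioo fun t ht => ?_).trans
      (lintegral_mono_set (Ioo_subset_Ioo (by linarith) hc))
    rw [mul_assoc]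
    exact hinner t ht
  have hroot := ENNReal.rpow_le_rpow hmain (one_div_nonneg.2 hp0.le)
  rw [← ENNReal.rpow_mul, mul_one_div_cancel hp0.ne', ENNReal.rpow_one,
    ENNReal.mul_rpow_of_nonneg _ _ (one_div_nonneg.2 hp0.le),
    ENNReal.ofReal_rpow_of_nonneg (by positivity) (one_div_nonneg.2 hp0.le), hM,
    rpow_scaling hp0 hr] at hroot
  change _ ≤ _ * wSlobSeminorm p μ s T u at hroot
  have := ENNReal.toReal_mono (ENNReal.mul_ne_top ENNReal.ofReal_ne_top hfin) hroot
  rwa [ENNReal.toReal_mul, toReal_enorm, ENNReal.toReal_ofReal (by positivity),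
    ← dist_eq_norm] at this

/-- Hölder estimate with the limiting exponent `s - (1 - μ) - 1 / p`, at scale `r`. -/
theorem dist_le_wSlobSeminorm {p μ s T x r : ℝ} {u : ℝ → E} (hp : 1 < p) (hμ : μ ≤ 1)
    (hs : 0 < s) (hγ : 0 < s - (1 - μ) - 1 / p) (hu : ContinuousOn u (Icc 0 T))
    (hfin : wSlobSeminorm p μ s T u ≠ ⊤) (hr : 0 < r) (hx : 0 ≤ x) (hxT : x + 2 * r ≤ T) :
    dist (u x) (u (x + 2 * r)) ≤
      (16 * 4 ^ ((1 - μ) * p)) ^ (1 / p) * r ^ (s - (1 - μ) - 1 / p) *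
        (wSlobSeminorm p μ s T u).toReal *
        (1 + 2 / (1 - (1 / 2) ^ (s - (1 - μ) - 1 / p))) := by
  set γ := s - (1 - μ) - 1 / p with hγdef
  set B := (16 * 4 ^ ((1 - μ) * p) : ℝ) ^ (1 / p) with hB
  set S := (wSlobSeminorm p μ s T u).toReal with hS
  set q : ℝ := (1 / 2) ^ γ with hq
  have hq1 : q < 1 := Real.rpow_lt_one (by norm_num) (by norm_num) hγ
  have hpow : ∀ n : ℕ, B * (r * (1 / 2) ^ n) ^ γ * S = B * r ^ γ * S * q ^ n := by
    intro n
    rw [Real.mul_rpow hr.le (by positivity), hq, ← Real.rpow_natCast, ← Real.rpow_natCast,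
      ← Real.rpow_mul (by norm_num), ← Real.rpow_mul (by norm_num), mul_comm (n : ℝ) γ]
    ring
  have hρ : ∀ n : ℕ, 0 < r * (1 / 2) ^ n ∧ r * (1 / 2) ^ n ≤ r := fun n =>
    ⟨by positivity, mul_le_of_le_one_right hr.le (pow_le_one₀ (by norm_num) (by norm_num))⟩
  have hlim : Tendsto (fun n : ℕ => r * (1 / 2 : ℝ) ^ n) atTop (𝓝 0) := by
    simpa using (tendsto_pow_atTop_nhds_zero_of_lt_one (by norm_num : (0 : ℝ) ≤ 1 / 2)
      (by norm_num)).const_mul r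
  have hright : dist (⨍ t in Ioo (x + r / 2) (x + r), u t) (u x) ≤ B * r ^ γ * S / (1 - q) := by
    have key := dist_le_of_le_geometric_of_tendsto₀ q (B * r ^ γ * S)
      (f := fun n : ℕ => ⨍ t in Ioo (x + r * (1 / 2) ^ n / 2) (x + r * (1 / 2) ^ n), u t)
      (a := u x) hq1 ?_ ?_
    · simpa using key
    · intro n
      have h := hρ n
      rw [← hpow n]
      have e : r * (1 / 2 : ℝ) ^ (n + 1) = r * (1 / 2) ^ n / 2 := by ring
      simp only [e]
      apply dist_setAverage_adjacent_le hp hμ hs hu hfin h.1 <;> linarith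
    · refine tendsto_setAverage_Ioo hu ⟨hx, by linarith⟩ (fun n => ?_) (fun n => ?_)
        (fun n => ?_) ?_ ?_
      · linarith [hρ n]
      · linarith [hρ n]
      · linarith [hρ n]
      · simpa using (hlim.div_const 2).const_add x
      · simpa using hlim.const_add x
  have hleft : dist (⨍ t in Ioo (x + 2 * r - r) (x + 2 * r - r / 2), u t) (u (x + 2 * r)) ≤
      B * r ^ γ * S / (1 - q) := by
    have key := dist_le_of_le_geometric_of_tendsto₀ q (B * r ^ γ * S)
      (f := fun n : ℕ => ⨍ t in Ioo (x + 2 * r - r * (1 / 2) ^ n)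
        (x + 2 * r - r * (1 / 2) ^ n / 2), u t)
      (a := u (x + 2 * r)) hq1 ?_ ?_
    · simpa using key
    · intro n
      have h := hρ n
      rw [← hpow n, dist_comm]
      have e : r * (1 / 2 : ℝ) ^ (n + 1) = r * (1 / 2) ^ n / 2 := by ring
      simp only [e]
      apply dist_setAverage_adjacent_le hp hμ hs hu hfin h.1 <;> linarith
    · refine tendsto_setAverage_Ioo hu ⟨by linarith, by linarith⟩ (fun n => ?_) (fun n => ?_)
        (fun n => ?_) ?_ ?_
      · linarith [hρ n]
      · linarith [hρ n]
      · linarith [hρ n]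
      · simpa using hlim.const_sub (x + 2 * r)
      · simpa using (hlim.div_const 2).const_sub (x + 2 * r)
  have hmid : dist (⨍ t in Ioo (x + 2 * r - r) (x + 2 * r - r / 2), u t)
      (⨍ t in Ioo (x + r / 2) (x + r), u t) ≤ B * r ^ γ * S := by
    rw [show x + 2 * r - r = x + r by ring]
    apply dist_setAverage_adjacent_le hp hμ hs hu hfin hr <;> linarith
  calc dist (u x) (u (x + 2 * r))
      ≤ dist (u x) (⨍ t in Ioo (x + r / 2) (x + r), u t) +
        dist (⨍ t in Ioo (x + r / 2) (x + r), u t)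
          (⨍ t in Ioo (x + 2 * r - r) (x + 2 * r - r / 2), u t) +
        dist (⨍ t in Ioo (x + 2 * r - r) (x + 2 * r - r / 2), u t) (u (x + 2 * r)) :=
        dist_triangle4 _ _ _ _
    _ ≤ B * r ^ γ * S / (1 - q) + B * r ^ γ * S + B * r ^ γ * S / (1 - q) :=
        add_le_add (add_le_add ((dist_comm _ _).trans_le hright)
          ((dist_comm _ _).trans_le hmid)) hleft
    _ = _ := by ring

end Intervals

end WeightedEmbedding

/-- embedding of the weighted Sobolev–Slobodetskii space into a Hölder space,
with constant uniform in `T ∈ (0, T₀]`: there is `C = C(T₀, p, μ, s, α)` such that for every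
`T ∈ (0, T₀]` and every continuous `u : [0,T] → E` with finite `W^s_{p,μ}`-norm,
`‖u‖_{C^α([0,T];E)} ≤ C (‖u‖_{W^s_{p,μ}((0,T);E)} + ‖u(0)‖)`, where the `C^α`-norm is
`sup_t ‖u t‖ + sup_{t ≠ τ} ‖u t − u τ‖/|t − τ|^α`. -/
theorem weighted_sobolev_holder_embedding
    (T₀ p μ s a : ℝ) (hT₀ : 0 < T₀) (hp : 1 < p) (hμ : μ ∈ Set.Ioc (1 / p) 1)
    (hs : s ∈ Set.Ioo (0:ℝ) 1) (hsμ : 1 - μ + 1 / p < s)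
    (ha : 0 < a) (ha' : a < s - (1 - μ) - 1 / p)
    (E : Type*) [NormedAddCommGroup E] [NormedSpace ℝ E] [CompleteSpace E] :
    ∃ C > 0, ∀ T ∈ Set.Ioc (0:ℝ) T₀, ∀ u : ℝ → E, ContinuousOn u (Set.Icc 0 T) →
      wSlobNorm p μ s T u ≠ ⊤ →
      sSup ((fun t => ‖u t‖) '' Set.Icc 0 T)
        + sSup ((fun q : ℝ × ℝ => ‖u q.1 - u q.2‖ / |q.1 - q.2| ^ a) ''
            {q : ℝ × ℝ | q.1 ∈ Set.Icc 0 T ∧ q.2 ∈ Set.Icc 0 T ∧ q.1 ≠ q.2})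
      ≤ C * ((wSlobNorm p μ s T u).toReal + ‖u 0‖) := by
  set γ := s - (1 - μ) - 1 / p with hγdef
  have hγ : 0 < γ := ha.trans ha'
  set B := (16 * 4 ^ ((1 - μ) * p) : ℝ) ^ (1 / p) * (1 + 2 / (1 - (1 / 2) ^ γ)) with hB
  have hq1 : ((1 / 2 : ℝ)) ^ γ < 1 := Real.rpow_lt_one (by norm_num) (by norm_num) hγ
  have hB0 : 0 ≤ B := by
    have : (0 : ℝ) < 1 - (1 / 2) ^ γ := by linarith
    positivity
  set D := B * T₀ ^ (γ - a) with hD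
  have hD0 : 0 ≤ D := by positivity
  refine ⟨1 + D * T₀ ^ a + D, by positivity, ?_⟩
  rintro T ⟨hT, hTT⟩ u hu hfin
  have hfinS : wSlobSeminorm p μ s T u ≠ ⊤ := (ENNReal.add_ne_top.1 hfin).2
  set S := (wSlobSeminorm p μ s T u).toReal with hS
  have hS0 : 0 ≤ S := ENNReal.toReal_nonneg
  have hSN : S ≤ (wSlobNorm p μ s T u).toReal := ENNReal.toReal_mono hfin le_add_self
  have hlt : ∀ x y, 0 ≤ x → x < y → y ≤ T → ‖u x - u y‖ ≤ D * S * |x - y| ^ a := by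
    intro x y hx hxy hy
    have hd : 0 < y - x := by linarith
    have h := dist_le_wSlobSeminorm (x := x) (r := (y - x) / 2) hp hμ.2 hs.1 hγ hu hfinS
      (by linarith) hx (by linarith)
    rw [show x + 2 * ((y - x) / 2) = y by ring, dist_eq_norm] at h
    have h1 : ((y - x) / 2) ^ γ ≤ T₀ ^ (γ - a) * (y - x) ^ a := by
      calc ((y - x) / 2) ^ γ ≤ (y - x) ^ γ := by gcongr; linarith
        _ = (y - x) ^ (γ - a) * (y - x) ^ a := by rw [← Real.rpow_add hd]; congr 1; ring
        _ ≤ T₀ ^ (γ - a) * (y - x) ^ a := by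
          have : 0 ≤ γ - a := by linarith
          gcongr
          linarith
    rw [abs_sub_comm, abs_of_pos hd]
    calc ‖u x - u y‖ ≤ B * S * ((y - x) / 2) ^ γ := h.trans_eq (by rw [hB]; ring)
      _ ≤ B * S * (T₀ ^ (γ - a) * (y - x) ^ a) := by gcongr
      _ = D * S * (y - x) ^ a := by rw [hD]; ring
  have hholder : ∀ x ∈ Set.Icc 0 T, ∀ y ∈ Set.Icc 0 T, x ≠ y →
      ‖u x - u y‖ ≤ D * S * |x - y| ^ a := by
    intro x hx y hy hxy
    rcases hxy.lt_or_gt with h | h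
    · exact hlt x y hx.1 h hy.2
    · rw [norm_sub_rev, abs_sub_comm]
      exact hlt y x hy.1 h hx.2
  have hsup : sSup ((fun t => ‖u t‖) '' Set.Icc 0 T) ≤ ‖u 0‖ + D * S * T₀ ^ a := by
    refine Real.sSup_le ?_ (by positivity)
    rintro _ ⟨t, ht, rfl⟩
    dsimp only
    rcases eq_or_ne t 0 with rfl | h0
    · have : 0 ≤ D * S * T₀ ^ a := by positivity
      linarith
    · have h1 := hholder t ht 0 ⟨le_rfl, hT.le⟩ h0
      rw [sub_zero, abs_of_nonneg ht.1] at h1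
      have h2 : D * S * t ^ a ≤ D * S * T₀ ^ a := by
        have := ht.1
        gcongr
        exact ht.2.trans hTT
      linarith [norm_le_norm_add_norm_sub (u 0) (u t), norm_sub_rev (u 0) (u t)]
  have hsemi : sSup ((fun q : ℝ × ℝ => ‖u q.1 - u q.2‖ / |q.1 - q.2| ^ a) ''
      {q : ℝ × ℝ | q.1 ∈ Set.Icc 0 T ∧ q.2 ∈ Set.Icc 0 T ∧ q.1 ≠ q.2}) ≤ D * S := by
    refine Real.sSup_le ?_ (by positivity)
    rintro _ ⟨q, ⟨h1, h2, h3⟩, rfl⟩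
    have : 0 < |q.1 - q.2| := abs_pos.2 (sub_ne_zero.2 h3)
    exact (div_le_iff₀ (by positivity)).2 (hholder q.1 h1 q.2 h2 h3)
  calc _ ≤ (‖u 0‖ + D * S * T₀ ^ a) + D * S := add_le_add hsup hsemi
    _ ≤ (1 + D * T₀ ^ a + D) * (S + ‖u 0‖) := by
      have : 0 ≤ S + (D * T₀ ^ a + D) * ‖u 0‖ := by positivity
      linarith
    _ ≤ _ := by gcongr
end

section
/- Let α ∈ (0, π), let Φ* : [0,1] → ℝ² be a regular C⁵ curve parametrized proportional to arc length satisfying the reference-curve boundary conditions, with nonvanishing maximal curvature ‖κ_Λ‖_{C⁰([0,1])} > 0, and let η be an admissible profile function. Let λ ∈ (0, 1], and set d := C_α / ‖κ_Λ‖_{C⁰([0,1])}. Then the map Ψ(σ, q) := Φ*(σ) + q·(n_Λ(σ) + cot α · η(σ) · τ_Λ(σ)) is a local diffeomorphism on [0,1] × (−λd, λd): it is C¹ and its Jacobian determinant satisfies |det DΨ(σ, q)| > (1 − λ) · L[Φ*] for all (σ, q) ∈ [0,1] × (−λd, λd). -/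
open scoped RealInnerProductSpace

open Set

/-- The rotation `rot` as a continuous linear map. -/
noncomputable def rotCLM : EuclideanSpace ℝ (Fin 2) →L[ℝ] EuclideanSpace ℝ (Fin 2) :=
  LinearMap.toContinuousLinearMap
    { toFun := rot
      map_add' := fun x y => by ext i; fin_cases i <;> simp [rot]; ring
      map_smul' := fun c x => by ext i; fin_cases i <;> simp [rot] }

@[simp] lemma rotCLM_apply (v : EuclideanSpace ℝ (Fin 2)) : rotCLM v = rot v := rfl

@[simp] lemma rot_apply_zero (v : EuclideanSpace ℝ (Fin 2)) : rot v 0 = -(v 1) := by simp [rot]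

@[simp] lemma rot_apply_one (v : EuclideanSpace ℝ (Fin 2)) : rot v 1 = v 0 := by simp [rot]

/-- The derivative within the domain is as smooth as expected, for any choice of derivative. -/
lemma contDiffOn_of_hasDerivWithinAt {E : Type*} [NormedAddCommGroup E] [NormedSpace ℝ E]
    {f f' : ℝ → E} {s : Set ℝ} {m n : WithTop ℕ∞} (hs : UniqueDiffOn ℝ s)
    (hf : ContDiffOn ℝ n f s) (hmn : m + 1 ≤ n)
    (hf' : ∀ x ∈ s, HasDerivWithinAt f (f' x) s x) : ContDiffOn ℝ m f' s :=
  (hf.derivWithin hs hmn).congr fun x hx => ((hf' x hx).derivWithin (hs x hx)).symm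

/-- The derivative of a ruled map `(σ, q) ↦ γ σ + q • V σ`. -/
lemma hasFDerivWithinAt_ruled {E : Type*} [NormedAddCommGroup E] [NormedSpace ℝ E]
    {γ V : ℝ → E} {γ' V' : E} {s t : Set ℝ} {p : ℝ × ℝ}
    (hγ : HasDerivWithinAt γ γ' s p.1) (hV : HasDerivWithinAt V V' s p.1) :
    HasFDerivWithinAt (fun x : ℝ × ℝ => γ x.1 + x.2 • V x.1)
      ((ContinuousLinearMap.fst ℝ ℝ ℝ).smulRight (γ' + p.2 • V') +
        (ContinuousLinearMap.snd ℝ ℝ ℝ).smulRight (V p.1)) (s ×ˢ t) p := by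
  have hfst : HasFDerivWithinAt (fun x : ℝ × ℝ => x.1) (ContinuousLinearMap.fst ℝ ℝ ℝ)
      (s ×ˢ t) p := hasFDerivWithinAt_fst
  have hsnd : HasFDerivWithinAt (fun x : ℝ × ℝ => x.2) (ContinuousLinearMap.snd ℝ ℝ ℝ)
      (s ×ˢ t) p := hasFDerivWithinAt_snd
  have hmaps : MapsTo (fun x : ℝ × ℝ => x.1) (s ×ˢ t) s := fun x hx => hx.1
  have h := (hγ.hasFDerivWithinAt.comp p hfst hmaps).add
    (hsnd.smul (hV.hasFDerivWithinAt.comp p hfst hmaps))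
  refine h.congr_fderiv ?_
  ext <;> simp

/-- A curve of constant speed has its second derivative along the rotated tangent. -/
lemma second_deriv_of_const_speed {Φ' : ℝ → EuclideanSpace ℝ (Fin 2)}
    {w : EuclideanSpace ℝ (Fin 2)} {s : Set ℝ} {L σ : ℝ} (hL : 0 < L)
    (hs : UniqueDiffWithinAt ℝ s σ) (hσ : σ ∈ s) (hspeed : ∀ x ∈ s, ‖Φ' x‖ = L)
    (hw : HasDerivWithinAt Φ' w s σ) :
    w = (⟪w, rot ((1 / L) • Φ' σ)⟫ / L) • rot (Φ' σ) := by
  have h1 : HasDerivWithinAt (fun x => ‖Φ' x‖ ^ 2) (2 * ⟪Φ' σ, w⟫) s σ := hw.norm_sq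
  have h2 : HasDerivWithinAt (fun x => ‖Φ' x‖ ^ 2) 0 s σ :=
    (hasDerivWithinAt_const σ s (L ^ 2)).congr (fun x hx => by simp [hspeed x hx])
      (by simp [hspeed σ hσ])
  have h3 : 2 * ⟪Φ' σ, w⟫ = 0 := hs.eq_deriv _ h1 h2
  have h4 : ‖Φ' σ‖ ^ 2 = L ^ 2 := by rw [hspeed σ hσ]
  rw [EuclideanSpace.norm_sq_eq] at h4
  simp only [PiLp.inner_apply, Fin.sum_univ_two, Real.norm_eq_abs, sq_abs, RCLike.inner_apply,
    conj_trivial] at h3 h4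
  have h5 : Φ' σ 0 ^ 2 + Φ' σ 1 ^ 2 ≠ 0 := by rw [h4]; positivity
  ext i
  fin_cases i
  · simp [PiLp.inner_apply, Fin.sum_univ_two]
    field_simp
    rw [← h4]
    linear_combination (Φ' σ 0 / 2) * h3
  · simp [PiLp.inner_apply, Fin.sum_univ_two]
    field_simp
    rw [← h4]
    linear_combination (Φ' σ 1 / 2) * h3

lemma norm_rot (v : EuclideanSpace ℝ (Fin 2)) : ‖rot v‖ = ‖v‖ := by
  rw [EuclideanSpace.norm_eq, EuclideanSpace.norm_eq]
  simp [Fin.sum_univ_two, add_comm]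

/-- Curvature-length inequality: a curve whose tangent turns from angle `α` to angle `-α`
has total curvature at least `2 sin α`. -/
lemma two_mul_sin_le_of_curvature_le {Φ' Φ'' : ℝ → EuclideanSpace ℝ (Fin 2)} {α L K : ℝ}
    (hL : 0 < L)
    (hderiv : ∀ σ ∈ Icc (0 : ℝ) 1, HasDerivWithinAt Φ' (Φ'' σ) (Icc 0 1) σ)
    (hbound : ∀ σ ∈ Icc (0 : ℝ) 1, ‖Φ'' σ‖ ≤ L ^ 2 * K)
    (h0 : Φ' 0 = L • vec2 (Real.cos α) (Real.sin α))
    (h1 : Φ' 1 = L • vec2 (Real.cos α) (-Real.sin α)) :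
    2 * Real.sin α ≤ L * K := by
  have h := (convex_Icc (0 : ℝ) 1).norm_image_sub_le_of_norm_hasDerivWithin_le hderiv hbound
    (right_mem_Icc.2 zero_le_one) (left_mem_Icc.2 zero_le_one)
  have hc := (PiLp.norm_apply_le (Φ' 0 - Φ' 1) 1).trans h
  have hv : (Φ' 0 - Φ' 1) 1 = L * (2 * Real.sin α) := by
    simp [h0, h1, vec2]; ring
  rw [hv, Real.norm_eq_abs] at hc
  have h2 := (le_abs_self _).trans hc
  simp only [zero_sub, norm_neg, norm_one, mul_one] at h2
  exact le_of_mul_le_mul_left (by linarith [sq L, mul_assoc L L K]) hL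

/-- The quantitative lower bound on the Jacobian of curvilinear coordinates. -/
lemma jacobian_lower_bound {L K S q l k c h h' M C : ℝ} (hL : 0 < L) (hK : 0 < K)
    (hLK : 1 ≤ C * (L * K)) (hk : |k| ≤ K) (hh : |h| ≤ 1) (hh' : |h'| ≤ M)
    (hS : S = 1 + c ^ 2 + C * |c| * M) (hSpos : 0 < S) (hq : |q| < l * (S⁻¹ / K)) :
    (1 - l) * L < |L - q * (L * k * (1 + c ^ 2 * h ^ 2) - c * h')| := by
  have hM : 0 ≤ M := (abs_nonneg _).trans hh'
  have hh2 : h ^ 2 ≤ 1 := (sq_le_one_iff_abs_le_one h).2 hh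
  have e1 : |L * k * (1 + c ^ 2 * h ^ 2)| ≤ L * K * (1 + c ^ 2) := by
    rw [abs_mul, abs_mul, abs_of_pos hL, abs_of_nonneg (by positivity : 0 ≤ 1 + c ^ 2 * h ^ 2)]
    gcongr
    nlinarith [sq_nonneg c]
  have e2 : |c * h'| ≤ L * K * (C * |c| * M) := by
    rw [abs_mul]
    calc |c| * |h'| ≤ 1 * (|c| * M) := by rw [one_mul]; gcongr
      _ ≤ C * (L * K) * (|c| * M) := by gcongr
      _ = _ := by ring
  have e3 : |L * k * (1 + c ^ 2 * h ^ 2) - c * h'| ≤ L * K * S := by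
    refine (abs_sub _ _).trans ?_
    rw [hS]; linarith
  have e4 : |q * (L * k * (1 + c ^ 2 * h ^ 2) - c * h')| < l * L := by
    rw [abs_mul]
    calc _ ≤ |q| * (L * K * S) := by gcongr
      _ < l * (S⁻¹ / K) * (L * K * S) := by gcongr
      _ = l * L := by field_simp
  refine lt_of_lt_of_le ?_ (le_abs_self _)
  linarith [le_abs_self (q * (L * k * (1 + c ^ 2 * h ^ 2) - c * h'))]

/-- with `d := C_α/‖κ_Λ‖_{C⁰}` and `λ ∈ (0,1]`, the curvilinear coordinate map
`Ψ(σ, q) = Φ*(σ) + q·(n_Λ(σ) + cot α · η(σ) · τ_Λ(σ))` is a local diffeomorphism on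
`[0,1] × (−λd, λd)`: it is `C¹` and `|det DΨ(σ,q)| > (1 − λ)·L[Φ*]` there. -/
theorem curvilinear_coordinates_local_diffeo
    (α : ℝ) (hα : α ∈ Set.Ioo 0 Real.pi)
    (L : ℝ) (hL : 0 < L)
    (Φ Φ' Φ'' : ℝ → EuclideanSpace ℝ (Fin 2))
    (hΦC5 : ContDiffOn ℝ 5 Φ (Set.Icc 0 1))
    (hΦ' : ∀ σ ∈ Set.Icc (0:ℝ) 1, HasDerivWithinAt Φ (Φ' σ) (Set.Icc 0 1) σ)
    (hΦ'' : ∀ σ ∈ Set.Icc (0:ℝ) 1, HasDerivWithinAt Φ' (Φ'' σ) (Set.Icc 0 1) σ)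
    (hspeed : ∀ σ ∈ Set.Icc (0:ℝ) 1, ‖Φ' σ‖ = L)
    -- reference-curve boundary conditions
    (hbc0 : Φ 0 1 = 0) (hbc1 : Φ 1 1 = 0)
    (hτ0 : Φ' 0 = L • vec2 (Real.cos α) (Real.sin α))
    (hτ1 : Φ' 1 = L • vec2 (Real.cos α) (-Real.sin α))
    (κ : ℝ → ℝ)
    (hκ : ∀ σ ∈ Set.Icc (0:ℝ) 1, κ σ = ⟪Φ'' σ, rot ((1 / L) • Φ' σ)⟫ / L ^ 2)
    (hκ0 : κ 0 = 0) (hκ1 : κ 1 = 0)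
    (K : ℝ) (hK : K = sSup ((fun σ => |κ σ|) '' Set.Icc 0 1)) (hKpos : 0 < K)
    -- admissible profile function
    (η η' : ℝ → ℝ)
    (hηsmooth : ContDiffOn ℝ (⊤ : ℕ∞) η (Set.Icc 0 1))
    (hη' : ∀ σ ∈ Set.Icc (0:ℝ) 1, HasDerivWithinAt η (η' σ) (Set.Icc 0 1) σ)
    (hηmono : MonotoneOn η (Set.Icc 0 1))
    (hηrange : ∀ σ ∈ Set.Icc (0:ℝ) 1, η σ ∈ Set.Icc (-1:ℝ) 1)
    (hη1 : ∀ σ ∈ Set.Ico (0:ℝ) (1/6), η σ = -1)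
    (hη2 : ∀ σ ∈ Set.Ico (1/3:ℝ) (2/3), η σ = 0)
    (hη3 : ∀ σ ∈ Set.Icc (5/6:ℝ) 1, η σ = 1)
    (Kη : ℝ) (hKη : Kη = sSup ((fun σ => |η' σ|) '' Set.Icc 0 1))
    -- constants
    (Chat Cα d lam : ℝ)
    (hChat : Chat = 1 / (Real.sqrt 2 * Real.sin α))
    (hCα : Cα = (1 + Real.cot α ^ 2 + Chat * |Real.cot α| * Kη)⁻¹)
    (hd : d = Cα / K)
    (hlam : lam ∈ Set.Ioc (0:ℝ) 1)
    -- the curvilinear coordinate map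
    (Ψ : ℝ × ℝ → EuclideanSpace ℝ (Fin 2))
    (hΨ : ∀ σ q : ℝ, Ψ (σ, q) =
      Φ σ + q • (rot ((1 / L) • Φ' σ) + (Real.cot α * η σ / L) • Φ' σ)) :
    ContDiffOn ℝ 1 Ψ (Set.Icc 0 1 ×ˢ Set.Ioo (-(lam * d)) (lam * d)) ∧
      ∀ p ∈ (Set.Icc (0:ℝ) 1 ×ˢ Set.Ioo (-(lam * d)) (lam * d)),
        (1 - lam) * L <
          |(fderivWithin ℝ Ψ (Set.Icc 0 1 ×ˢ Set.Ioo (-(lam * d)) (lam * d)) p (1, 0)) 0 *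
              (fderivWithin ℝ Ψ (Set.Icc 0 1 ×ˢ Set.Ioo (-(lam * d)) (lam * d)) p (0, 1)) 1 -
            (fderivWithin ℝ Ψ (Set.Icc 0 1 ×ˢ Set.Ioo (-(lam * d)) (lam * d)) p (1, 0)) 1 *
              (fderivWithin ℝ Ψ (Set.Icc 0 1 ×ˢ Set.Ioo (-(lam * d)) (lam * d)) p (0, 1)) 0| := by
  have hu : UniqueDiffOn ℝ (Icc (0 : ℝ) 1) := uniqueDiffOn_Icc zero_lt_one
  have hsin : 0 < Real.sin α := Real.sin_pos_of_pos_of_lt_pi hα.1 hα.2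
  have hκK : ∀ σ ∈ Icc (0 : ℝ) 1, |κ σ| ≤ K := by
    intro σ hσ
    have hbdd : BddAbove ((fun σ => |κ σ|) '' Icc 0 1) := by
      by_contra h
      rw [Real.sSup_of_not_bddAbove h] at hK
      exact hKpos.ne' hK
    rw [hK]
    exact le_csSup hbdd (mem_image_of_mem _ hσ)
  have hη'cont : ContinuousOn η' (Icc 0 1) :=
    (contDiffOn_of_hasDerivWithinAt (m := 0) hu hηsmooth (by simp) hη').continuousOn
  have hηK : ∀ σ ∈ Icc (0 : ℝ) 1, |η' σ| ≤ Kη := by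
    intro σ hσ
    rw [hKη]
    exact le_csSup (isCompact_Icc.bddAbove_image hη'cont.abs) (mem_image_of_mem _ hσ)
  have hKη0 : 0 ≤ Kη := (abs_nonneg _).trans (hηK 0 (left_mem_Icc.2 zero_le_one))
  have hΦ''eq : ∀ σ ∈ Icc (0 : ℝ) 1, Φ'' σ = (L * κ σ) • rot (Φ' σ) := by
    intro σ hσ
    rw [second_deriv_of_const_speed hL (hu σ hσ) hσ hspeed (hΦ'' σ hσ), hκ σ hσ]
    congr 1
    field_simp
  have hLK : 2 * Real.sin α ≤ L * K := by
    refine two_mul_sin_le_of_curvature_le hL hΦ'' (fun σ hσ => ?_) hτ0 hτ1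
    rw [hΦ''eq σ hσ, norm_smul, norm_rot, hspeed σ hσ, Real.norm_eq_abs, abs_mul, abs_of_pos hL]
    nlinarith [hκK σ hσ, mul_pos hL hL]
  have hChatpos : 0 < Chat := by rw [hChat]; positivity
  have hCLK : 1 ≤ Chat * (L * K) := by
    have h2 : Real.sqrt 2 ≤ 2 := Real.sqrt_le_iff.2 (by norm_num)
    rw [hChat, one_div, inv_mul_eq_div, one_le_div (by positivity)]
    nlinarith
  have hSpos : 0 < 1 + Real.cot α ^ 2 + Chat * |Real.cot α| * Kη := by positivity
  have huP : UniqueDiffOn ℝ (Icc (0 : ℝ) 1 ×ˢ Ioo (-(lam * d)) (lam * d)) :=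
    hu.prod (uniqueDiffOn_Ioo _ _)
  have hΨeq : Ψ = fun x : ℝ × ℝ => Φ x.1 +
      x.2 • (rotCLM ((1 / L) • Φ' x.1) + (Real.cot α * η x.1 / L) • Φ' x.1) :=
    funext fun x => hΨ x.1 x.2
  constructor
  · have hfst : ContDiffOn ℝ 1 (fun x : ℝ × ℝ => x.1)
        (Icc (0 : ℝ) 1 ×ˢ Ioo (-(lam * d)) (lam * d)) := contDiff_fst.contDiffOn
    have hmaps : MapsTo (fun x : ℝ × ℝ => x.1)
        (Icc (0 : ℝ) 1 ×ˢ Ioo (-(lam * d)) (lam * d)) (Icc 0 1) := fun x hx => hx.1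
    have cΦ := (hΦC5.of_le (m := 1) (by norm_num)).comp hfst hmaps
    have cΦ' := (contDiffOn_of_hasDerivWithinAt (m := 1) hu hΦC5 (by norm_num) hΦ').comp hfst hmaps
    have cη := (hηsmooth.of_le (m := 1) (by exact_mod_cast le_top)).comp hfst hmaps
    rw [hΨeq]
    have cn := rotCLM.contDiff.comp_contDiffOn (cΦ'.const_smul (1 / L))
    have ct := ((contDiffOn_const (c := Real.cot α)).mul cη).div_const L |>.smul cΦ'
    exact cΦ.add (contDiff_snd.contDiffOn.smul (cn.add ct))
  · rintro ⟨σ, q⟩ ⟨hσ, hq⟩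
    simp only at hσ hq
    have hV := (rotCLM.hasFDerivAt.comp_hasDerivWithinAt σ ((hΦ'' σ hσ).const_smul (1 / L))).add
      ((((hη' σ hσ).const_mul (Real.cot α)).div_const L).smul (hΦ'' σ hσ))
    have hD := hasFDerivWithinAt_ruled (t := Ioo (-(lam * d)) (lam * d)) (p := (σ, q))
      (hΦ' σ hσ) hV
    replace hD := hD.congr_of_eventuallyEq (f₁ := Ψ)
      (Filter.Eventually.of_forall fun x => hΨ x.1 x.2) (hΨ σ q)
    have hnorm : ‖Φ' σ‖ ^ 2 = L ^ 2 := by rw [hspeed σ hσ]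
    rw [EuclideanSpace.norm_sq_eq] at hnorm
    simp only [Fin.sum_univ_two, Real.norm_eq_abs, sq_abs] at hnorm
    rw [show fderivWithin ℝ Ψ (Icc 0 1 ×ˢ Ioo (-(lam * d)) (lam * d)) (σ, q) = _ from
      hD.fderivWithin (huP _ ⟨hσ, hq⟩)]
    have key := jacobian_lower_bound hL hKpos hCLK (hκK σ hσ) (abs_le.2 (hηrange σ hσ))
      (hηK σ hσ) rfl hSpos (c := Real.cot α) (q := q) (l := lam)
      (by rw [← hCα, ← hd]; exact abs_lt.2 hq)
    refine key.trans_eq (congrArg _ ?_)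
    rw [hΦ''eq σ hσ]
    simp
    field_simp
    linear_combination
      (-(L - q * (L * κ σ * (1 + Real.cot α ^ 2 * η σ ^ 2) - Real.cot α * η' σ))) * hnorm
end

section
/- Let α ∈ (0,π), Φ*, η, f₀, λ, ξ₀, ξ₁ be as in Theorem 3.6 of the paper (in particular sup_σ |f₀(σ) − Φ*(σ)| < ξ₀ and sup_σ |∂_σ f₀(σ) − ∂_σ Φ*(σ)| < ξ₁). Then the level set {σ ∈ [0,1] : [Φ*(σ)]₂ = ξ₀} is nonempty, and, denoting x := min{σ ∈ [0,1] : [Φ*(σ)]₂ = ξ₀} and y := max{σ ∈ [0,1] : [Φ*(σ)]₂ = ξ₀}, one has [f₀(σ)]₂ > 0 for all σ ∈ (0, x) ∪ (y, 1). -/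
open scoped RealInnerProductSpace

/-- The quantity `S(α)`: `1/(2·(4·144)²·|cot α|²)` for `α ≠ π/2` and `1` for `α = π/2`. -/
noncomputable def Sconst (α : ℝ) : ℝ :=
  if α = Real.pi / 2 then 1 else 1 / (2 * (4 * 144 : ℝ) ^ 2 * |Real.cot α| ^ 2)

open Set in
/-- On `[0, 1]`, if `h` starts at `0` with slope `s` and `|h''| ≤ M`, and `g` starts at `0` with
`g' > h' - s / 2`, then `h` attains every level in `[0, s² / (2M)]` on `[0, s / M]`, and `g` is
positive on `(0, s / M]`. -/
lemma exists_level_and_pos_of_second_deriv_bound {h h' h'' g g' : ℝ → ℝ} {s M ξ : ℝ}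
    (hs : 0 < s) (hM : s ≤ M)
    (hh : ∀ x ∈ Icc (0:ℝ) 1, HasDerivWithinAt h (h' x) (Icc 0 1) x)
    (hh' : ∀ x ∈ Icc (0:ℝ) 1, HasDerivWithinAt h' (h'' x) (Icc 0 1) x)
    (hg : ∀ x ∈ Icc (0:ℝ) 1, HasDerivWithinAt g (g' x) (Icc 0 1) x)
    (hb : ∀ x ∈ Icc (0:ℝ) 1, |h'' x| ≤ M)
    (hgh : ∀ x ∈ Icc (0:ℝ) 1, h' x - s / 2 < g' x)
    (h0 : h 0 = 0) (h0' : h' 0 = s) (g0 : g 0 = 0)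
    (hξ0 : 0 ≤ ξ) (hξ : ξ ≤ s ^ 2 / (2 * M)) :
    (∃ c ∈ Icc 0 (s / M), h c = ξ) ∧ ∀ x ∈ Ioc 0 (s / M), 0 < g x := by
  have hMpos : 0 < M := hs.trans_le hM
  have hle : s / M ≤ 1 := (div_le_one hMpos).2 hM
  have hsM : 0 ≤ s / M := by positivity
  have zero_mem : (0:ℝ) ∈ Icc (0:ℝ) 1 := by simp
  have slope : ∀ x ∈ Icc (0:ℝ) 1, s - M * x ≤ h' x := by
    have der : ∀ x ∈ Icc (0:ℝ) 1,
        HasDerivWithinAt (fun y => h' y + M * y) (h'' x + M) (Icc 0 1) x := fun x hx =>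
      ((hh' x hx).add ((hasDerivWithinAt_id x (Icc (0:ℝ) 1)).const_mul M)).congr_deriv (by simp)
    have mono : MonotoneOn (fun y => h' y + M * y) (Icc 0 1) :=
      monotoneOn_of_hasDerivWithinAt_nonneg (convex_Icc 0 1)
        (fun x hx => (der x hx).continuousWithinAt)
        (fun x hx => (der x (interior_subset hx)).mono interior_subset)
        (fun x hx => by linarith [(abs_le.1 (hb x (interior_subset hx))).1])
    intro x hx
    have := mono zero_mem hx hx.1
    simp only [mul_zero, h0'] at this
    linarith
  have quad : ∀ (a x : ℝ), HasDerivWithinAt (fun y : ℝ => M * y ^ 2 / 2 - a * y)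
      (M * x - a) (Icc 0 1) x := fun a x => by
    have := ((((hasDerivAt_id x).pow 2).const_mul M).div_const 2).sub
      ((hasDerivAt_id x).const_mul a)
    refine (this.congr_deriv ?_).hasDerivWithinAt
    simp
    ring
  have height : s ^ 2 / (2 * M) ≤ h (s / M) := by
    have der := fun x (hx : x ∈ Icc (0:ℝ) 1) => (hh x hx).add (quad s x)
    have mono := monotoneOn_of_hasDerivWithinAt_nonneg (convex_Icc 0 1)
        (fun x hx => (der x hx).continuousWithinAt)
        (fun x hx => (der x (interior_subset hx)).mono interior_subset)
        (fun x hx => by linarith [slope x (interior_subset hx)])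
    have := mono zero_mem ⟨hsM, hle⟩ hsM
    simp only [Pi.add_apply, h0] at this
    have e : M * (s / M) ^ 2 / 2 - s * (s / M) = - (s ^ 2 / (2 * M)) := by
      field_simp
      ring
    rw [e] at this
    norm_num at this
    linarith
  constructor
  · have cont : ContinuousOn h (Icc 0 (s / M)) := fun x hx =>
      ((hh x ⟨hx.1, hx.2.trans hle⟩).continuousWithinAt).mono (Icc_subset_Icc_right hle)
    obtain ⟨c, hc, hcξ⟩ := intermediate_value_Icc hsM cont
      (show ξ ∈ Icc (h 0) (h (s / M)) from ⟨by rw [h0]; exact hξ0, hξ.trans height⟩)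
    exact ⟨c, hc, hcξ⟩
  · have der := fun x (hx : x ∈ Icc (0:ℝ) 1) => (hg x hx).add (quad (s / 2) x)
    have mono := strictMonoOn_of_hasDerivWithinAt_pos (convex_Icc 0 1)
        (fun x hx => (der x hx).continuousWithinAt)
        (fun x hx => (der x (interior_subset hx)).mono interior_subset)
        (fun x hx => by
          linarith [slope x (interior_subset hx), hgh x (interior_subset hx)])
    intro x hx
    have := mono zero_mem ⟨hx.1.le, hx.2.trans hle⟩ hx.1
    simp only [Pi.add_apply, g0] at this
    have hMx : M * x ≤ s := by
      have := (le_div_iff₀ hMpos).1 hx.2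
      linarith
    nlinarith [hx.1]

open Set in
lemma HasDerivWithinAt.comp_one_sub {f f' : ℝ → ℝ}
    (hf : ∀ x ∈ Icc (0:ℝ) 1, HasDerivWithinAt f (f' x) (Icc 0 1) x) :
    ∀ x ∈ Icc (0:ℝ) 1, HasDerivWithinAt (fun y => f (1 - y)) (-f' (1 - x)) (Icc 0 1) x := by
  intro x hx
  have maps : MapsTo (fun y : ℝ => 1 - y) (Icc 0 1) (Icc 0 1) :=
    fun y hy => ⟨by linarith [hy.2], by linarith [hy.1]⟩
  have := (hf (1 - x) (maps hx)).comp x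
    ((hasDerivWithinAt_id x (Icc (0:ℝ) 1)).const_sub 1) maps
  simpa [Function.comp_def] using this

lemma HasDerivWithinAt.euclidean_apply {f : ℝ → EuclideanSpace ℝ (Fin 2)}
    {f' : EuclideanSpace ℝ (Fin 2)} {s : Set ℝ} {x : ℝ} (hf : HasDerivWithinAt f f' s x)
    (i : Fin 2) : HasDerivWithinAt (fun y => f y i) (f' i) s x :=
  (EuclideanSpace.proj (𝕜 := ℝ) i).hasFDerivAt.comp_hasDerivWithinAt x hf

/-- A planar vector `q` orthogonal to a vector `p` of length `L` has second coordinate at most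
`L² |k|`, where `k` is the associated signed curvature. -/
lemma abs_apply_one_le_of_inner_eq_zero {p q : EuclideanSpace ℝ (Fin 2)} {L k : ℝ} (hL : 0 < L)
    (hp : ‖p‖ = L) (hpq : ⟪q, p⟫ = 0) (hk : k = ⟪q, rot ((1 / L) • p)⟫ / L ^ 2) :
    |q 1| ≤ |k| * L ^ 2 := by
  have hsq : p 0 ^ 2 + p 1 ^ 2 = L ^ 2 := by
    rw [← hp, EuclideanSpace.real_norm_sq_eq, Fin.sum_univ_two]
  have hp0 : |p 0| ≤ L := abs_le_of_sq_le_sq (by nlinarith [sq_nonneg (p 1)]) hL.le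
  have horth : q 0 * p 0 + q 1 * p 1 = 0 := by
    simpa [PiLp.inner_apply, Fin.sum_univ_two, mul_comm] using hpq
  have hcurv : k * L ^ 3 = q 1 * p 0 - q 0 * p 1 := by
    rw [hk]
    simp [rot, PiLp.inner_apply, Fin.sum_univ_two]
    field_simp
    ring
  have key : q 1 * L ^ 2 = p 0 * k * L * L ^ 2 := by
    linear_combination -q 1 * hsq - p 0 * hcurv + p 1 * horth
  have hq : q 1 = p 0 * k * L := mul_right_cancel₀ (by positivity) key
  rw [hq, abs_mul, abs_mul, abs_of_pos hL]
  calc |p 0| * |k| * L ≤ L * |k| * L := by gcongr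
    _ = |k| * L ^ 2 := by ring

/-- Lemma 3.13: under the hypotheses of Theorem 3.6, the level set
`{σ ∈ [0,1] : [Φ*(σ)]₂ = ξ₀}` is nonempty, and with `x` its minimum and `y` its maximum,
`[f₀(σ)]₂ > 0` for all `σ ∈ (0, x) ∪ (y, 1)`. -/
theorem initial_curve_positive_near_boundary
    (α : ℝ) (hα : α ∈ Set.Ioo 0 Real.pi)
    (L : ℝ) (hL : 0 < L)
    (Φ Φ' Φ'' : ℝ → EuclideanSpace ℝ (Fin 2))
    (hΦC5 : ContDiffOn ℝ 5 Φ (Set.Icc 0 1))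
    (hΦ' : ∀ σ ∈ Set.Icc (0:ℝ) 1, HasDerivWithinAt Φ (Φ' σ) (Set.Icc 0 1) σ)
    (hΦ'' : ∀ σ ∈ Set.Icc (0:ℝ) 1, HasDerivWithinAt Φ' (Φ'' σ) (Set.Icc 0 1) σ)
    (hspeed : ∀ σ ∈ Set.Icc (0:ℝ) 1, ‖Φ' σ‖ = L)
    -- reference-curve boundary conditions
    (hbc0 : Φ 0 1 = 0) (hbc1 : Φ 1 1 = 0)
    (hτ0 : Φ' 0 = L • vec2 (Real.cos α) (Real.sin α))
    (hτ1 : Φ' 1 = L • vec2 (Real.cos α) (-Real.sin α))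
    (κ : ℝ → ℝ)
    (hκ : ∀ σ ∈ Set.Icc (0:ℝ) 1, κ σ = ⟪Φ'' σ, rot ((1 / L) • Φ' σ)⟫ / L ^ 2)
    (hκ0 : κ 0 = 0) (hκ1 : κ 1 = 0)
    (K : ℝ) (hK : K = sSup ((fun σ => |κ σ|) '' Set.Icc 0 1)) (hKpos : 0 < K)
    -- admissible profile function
    (η η' : ℝ → ℝ)
    (hηsmooth : ContDiffOn ℝ (⊤ : ℕ∞) η (Set.Icc 0 1))
    (hη' : ∀ σ ∈ Set.Icc (0:ℝ) 1, HasDerivWithinAt η (η' σ) (Set.Icc 0 1) σ)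
    (hηmono : MonotoneOn η (Set.Icc 0 1))
    (hηrange : ∀ σ ∈ Set.Icc (0:ℝ) 1, η σ ∈ Set.Icc (-1:ℝ) 1)
    (hη1 : ∀ σ ∈ Set.Ico (0:ℝ) (1/6), η σ = -1)
    (hη2 : ∀ σ ∈ Set.Ico (1/3:ℝ) (2/3), η σ = 0)
    (hη3 : ∀ σ ∈ Set.Icc (5/6:ℝ) 1, η σ = 1)
    (Kη : ℝ) (hKη : Kη = sSup ((fun σ => |η' σ|) '' Set.Icc 0 1))
    -- constants
    (Chat Cα Cbar : ℝ)
    (hChat : Chat = 1 / (Real.sqrt 2 * Real.sin α))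
    (hCα : Cα = (1 + Real.cot α ^ 2 + Chat * |Real.cot α| * Kη)⁻¹)
    -- the initial curve: regular, C¹, with the initial-curve boundary conditions
    (f₀ f₀' : ℝ → EuclideanSpace ℝ (Fin 2))
    (hf₀' : ∀ σ ∈ Set.Icc (0:ℝ) 1, HasDerivWithinAt f₀ (f₀' σ) (Set.Icc 0 1) σ)
    (hf₀'cont : ContinuousOn f₀' (Set.Icc 0 1))
    (hf₀reg : ∀ σ ∈ Set.Icc (0:ℝ) 1, f₀' σ ≠ 0)
    (hf₀bc0 : f₀ 0 1 = 0) (hf₀bc1 : f₀ 1 1 = 0)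
    (hf₀τ0 : f₀' 0 = ‖f₀' 0‖ • vec2 (Real.cos α) (Real.sin α))
    (hf₀τ1 : f₀' 1 = ‖f₀' 1‖ • vec2 (Real.cos α) (-Real.sin α))
    -- λ with the smallness conditions (3.4) and (3.5)
    (lam : ℝ) (hlam : lam ∈ Set.Ioo (0:ℝ) 1)
    (hCbar : Cbar = 1 - Real.sqrt ((lam * Cα * Real.cot α) ^ 2 + (1 - lam * Cα) ^ 2))
    (h34 : lam * Cα * Real.sqrt (1 + Real.cot α ^ 2) <
      min (Real.sin ((Real.sqrt (Real.cot α ^ 2 + 1) - |Real.cot α|) / 4))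
        (if α = Real.pi / 2 then 1 else Real.sin (Sconst α)))
    (h35 : lam < min (1 / (6 * Real.sqrt (1 + Real.cot α ^ 2)))
        (if α = Real.pi / 2 then 1 else 1 / (144 * |Real.cot α|)))
    -- the radii ξ₀ and ξ₁
    (ξ₀ ξ₁ : ℝ)
    (hξ₀ : ξ₀ = min Cbar (Real.sin α ^ 2 / 2) / K)
    (hξ₁ : ξ₁ = min (min ((Real.sqrt (Real.cot α ^ 2 + 1) - |Real.cot α|) / 4) (Sconst α))
        (Real.sin α / 2) * L)
    -- closeness hypotheses
    (hclose0 : ∀ σ ∈ Set.Icc (0:ℝ) 1, ‖f₀ σ - Φ σ‖ < ξ₀)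
    (hclose1 : ∀ σ ∈ Set.Icc (0:ℝ) 1, ‖f₀' σ - Φ' σ‖ < ξ₁) :
    {σ ∈ Set.Icc (0:ℝ) 1 | Φ σ 1 = ξ₀}.Nonempty ∧
      ∀ σ ∈ Set.Ioo (0:ℝ) (sInf {σ ∈ Set.Icc (0:ℝ) 1 | Φ σ 1 = ξ₀}) ∪
          Set.Ioo (sSup {σ ∈ Set.Icc (0:ℝ) 1 | Φ σ 1 = ξ₀}) 1,
        0 < f₀ σ 1 := by
  have hsin : 0 < Real.sin α := Real.sin_pos_of_mem_Ioo hα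
  have one_sub_mem : ∀ {x : ℝ}, x ∈ Set.Icc (0:ℝ) 1 → 1 - x ∈ Set.Icc (0:ℝ) 1 :=
    fun hx => ⟨by linarith [hx.2], by linarith [hx.1]⟩
  have hκK : ∀ σ ∈ Set.Icc (0:ℝ) 1, |κ σ| ≤ K := by
    have bdd : BddAbove ((fun σ => |κ σ|) '' Set.Icc 0 1) := by
      by_contra hn
      rw [hK, Real.sSup_of_not_bddAbove hn] at hKpos
      exact lt_irrefl _ hKpos
    intro σ hσ
    rw [hK]
    exact le_csSup bdd ⟨σ, hσ, rfl⟩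
  have horth : ∀ σ ∈ Set.Icc (0:ℝ) 1, ⟪Φ'' σ, Φ' σ⟫ = 0 := by
    intro σ hσ
    have hsqd := (hΦ'' σ hσ).inner ℝ (hΦ'' σ hσ)
    have hconst : HasDerivWithinAt (fun t => ⟪Φ' t, Φ' t⟫) 0 (Set.Icc 0 1) σ :=
      (hasDerivWithinAt_const σ _ (L ^ 2)).congr
        (fun t ht => by rw [real_inner_self_eq_norm_sq, hspeed t ht])
        (by rw [real_inner_self_eq_norm_sq, hspeed σ hσ])
    have := (uniqueDiffOn_Icc zero_lt_one σ hσ).eq_deriv _ hsqd hconst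
    rw [real_inner_comm] at this
    linarith
  have hsecond : ∀ σ ∈ Set.Icc (0:ℝ) 1, |Φ'' σ 1| ≤ K * L ^ 2 := fun σ hσ =>
    (abs_apply_one_le_of_inner_eq_zero hL (hspeed σ hσ) (horth σ hσ) (hκ σ hσ)).trans
      (by gcongr; exact hκK σ hσ)
  have hdiff : ∀ σ ∈ Set.Icc (0:ℝ) 1, |f₀' σ 1 - Φ' σ 1| < L * Real.sin α / 2 := fun σ hσ =>
    calc |f₀' σ 1 - Φ' σ 1| ≤ ‖f₀' σ - Φ' σ‖ := by
          simpa using PiLp.norm_apply_le (f₀' σ - Φ' σ) 1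
      _ < ξ₁ := hclose1 σ hσ
      _ ≤ Real.sin α / 2 * L := by rw [hξ₁]; gcongr; exact min_le_right _ _
      _ = L * Real.sin α / 2 := by ring
  have hξ₀nonneg : 0 ≤ ξ₀ := (norm_nonneg _).trans (hclose0 0 (by simp)).le
  have hs : 0 < L * Real.sin α := by positivity
  have hξ₀le : ξ₀ ≤ (L * Real.sin α) ^ 2 / (2 * (K * L ^ 2)) :=
    calc ξ₀ ≤ (Real.sin α ^ 2 / 2) / K := by rw [hξ₀]; gcongr; exact min_le_right _ _
      _ = (L * Real.sin α) ^ 2 / (2 * (K * L ^ 2)) := by field_simp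
  have hs0 : Φ' 0 1 = L * Real.sin α := by simp [hτ0, vec2]
  have hs1 : Φ' 1 1 = -(L * Real.sin α) := by simp [hτ1, vec2]
  have dΦ := fun σ hσ => (hΦ' σ hσ).euclidean_apply 1
  have dΦ' := fun σ hσ => (hΦ'' σ hσ).euclidean_apply 1
  have df := fun σ hσ => (hf₀' σ hσ).euclidean_apply 1
  have h2s : 2 * (L * Real.sin α) ≤ K * L ^ 2 := by
    have := (convex_Icc (0:ℝ) 1).norm_image_sub_le_of_norm_hasDerivWithin_le dΦ'
      (fun σ hσ => hsecond σ hσ) (x := 0) (y := 1) (by simp) (by simp)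
    rw [hs0, hs1, Real.norm_eq_abs] at this
    norm_num at this
    have := (abs_le.1 this).1
    linarith
  have hsM : L * Real.sin α ≤ K * L ^ 2 := by linarith
  have hle : L * Real.sin α / (K * L ^ 2) ≤ 1 := (div_le_one (by positivity)).2 hsM
  obtain ⟨⟨c, hc, hcξ⟩, hpos⟩ := exists_level_and_pos_of_second_deriv_bound hs hsM dΦ dΦ' df
    hsecond (fun σ hσ => by linarith [(abs_lt.1 (hdiff σ hσ)).1]) hbc0 hs0 hf₀bc0 hξ₀nonneg hξ₀le
  obtain ⟨⟨d, hd, hdξ⟩, hpos'⟩ := exists_level_and_pos_of_second_deriv_bound hs hsM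
    (HasDerivWithinAt.comp_one_sub dΦ)
    (fun σ hσ => (HasDerivWithinAt.comp_one_sub dΦ' σ hσ).neg.congr_deriv (neg_neg _))
    (HasDerivWithinAt.comp_one_sub df)
    (fun σ hσ => hsecond _ (one_sub_mem hσ))
    (fun σ hσ => by linarith [(abs_lt.1 (hdiff _ (one_sub_mem hσ))).2])
    (by simpa using hbc1) (by simp [hs1]) (by simpa using hf₀bc1) hξ₀nonneg hξ₀le
  have hcmem : c ∈ {σ ∈ Set.Icc (0:ℝ) 1 | Φ σ 1 = ξ₀} := ⟨⟨hc.1, hc.2.trans hle⟩, hcξ⟩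
  have hdmem : 1 - d ∈ {σ ∈ Set.Icc (0:ℝ) 1 | Φ σ 1 = ξ₀} :=
    ⟨one_sub_mem ⟨hd.1, hd.2.trans hle⟩, hdξ⟩
  refine ⟨⟨c, hcmem⟩, ?_⟩
  rintro σ (hσ | hσ)
  · have hinf : sInf {σ ∈ Set.Icc (0:ℝ) 1 | Φ σ 1 = ξ₀} ≤ c :=
      csInf_le ⟨0, fun t ht => ht.1.1⟩ hcmem
    exact hpos σ ⟨hσ.1, hσ.2.le.trans (hinf.trans hc.2)⟩
  · have hsup : 1 - d ≤ sSup {σ ∈ Set.Icc (0:ℝ) 1 | Φ σ 1 = ξ₀} :=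
      le_csSup ⟨1, fun t ht => ht.1.2⟩ hdmem
    have := hpos' (1 - σ) ⟨by linarith [hσ.2], by linarith [hσ.1, hd.2]⟩
    simpa using this
end

section
/- Let α ∈ (0, π), L > 0, K > 0, and 0 < ξ₁ < L sin α. Let Φ : [0,1] → ℝ² be a C² curve with |Φ'(σ)| = L for all σ, Φ'(0) = L·(cos α, sin α), and |Φ''(σ)| ≤ K L² for all σ. Let f : [0,1] → ℝ² be a C¹ curve with [f(0)]₂ = 0 and |f'(σ) − Φ'(σ)| ≤ ξ₁ for all σ. Then [f(σ)]₂ > 0 for all σ ∈ (0, 1] with σ < z₊, where z₊ := 2(L sin α − ξ₁)/(K L²). -/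
theorem EuclideanSpace.hasDerivWithinAt_apply {ι : Type*} [Fintype ι]
    {g : ℝ → EuclideanSpace ℝ ι} {g' : EuclideanSpace ℝ ι} {s : Set ℝ} {x : ℝ}
    (h : HasDerivWithinAt g g' s x) (i : ι) :
    HasDerivWithinAt (fun t => g t i) (g' i) s x :=
  (EuclideanSpace.proj i : EuclideanSpace ℝ ι →L[ℝ] ℝ).hasFDerivAt.comp_hasDerivWithinAt x h

theorem image_le_of_hasDerivWithinAt_Icc_le {a b : ℝ} {u u' v v' : ℝ → ℝ}
    (hu : ∀ t ∈ Set.Icc a b, HasDerivWithinAt u (u' t) (Set.Icc a b) t)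
    (hv : ∀ t ∈ Set.Icc a b, HasDerivWithinAt v (v' t) (Set.Icc a b) t)
    (hle : ∀ t ∈ Set.Icc a b, u' t ≤ v' t) (h₀ : u a ≤ v a) :
    ∀ t ∈ Set.Icc a b, u t ≤ v t := by
  have hmono : MonotoneOn (fun t => v t - u t) (Set.Icc a b) :=
    monotoneOn_of_hasDerivWithinAt_nonneg (f' := fun t => v' t - u' t) (convex_Icc a b)
      (fun t ht => ((hv t ht).sub (hu t ht)).continuousWithinAt)
      (fun t ht => ((hv t (interior_subset ht)).sub (hu t (interior_subset ht))).mono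
        interior_subset)
      (fun t ht => sub_nonneg.2 (hle t (interior_subset ht)))
  intro t ht
  have h : v a - u a ≤ v t - u t :=
    hmono (Set.left_mem_Icc.2 (ht.1.trans ht.2)) ht ht.1
  linarith


/-- Let `α ∈ (0, π)`, `L > 0`, `K > 0`, `0 < ξ₁ < L sin α`. Let `Φ` be a `C²`
curve with `|Φ'| ≡ L`, `Φ'(0) = L·(cos α, sin α)`, `|Φ''| ≤ K L²`, and let `f` be a `C¹`
curve with `[f(0)]₂ = 0` and `|f' − Φ'| ≤ ξ₁` on `[0,1]`. Then `[f(σ)]₂ > 0` for all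
`σ ∈ (0,1]` with `σ < z₊ := 2(L sin α − ξ₁)/(K L²)`. -/
theorem second_coordinate_positive
    (α L K ξ₁ : ℝ) (hα : α ∈ Set.Ioo 0 Real.pi) (hL : 0 < L) (hK : 0 < K)
    (hξ₁ : 0 < ξ₁) (hξ₁' : ξ₁ < L * Real.sin α)
    (Φ Φ' Φ'' : ℝ → EuclideanSpace ℝ (Fin 2))
    (hΦ' : ∀ σ ∈ Set.Icc (0:ℝ) 1, HasDerivWithinAt Φ (Φ' σ) (Set.Icc 0 1) σ)
    (hΦ'' : ∀ σ ∈ Set.Icc (0:ℝ) 1, HasDerivWithinAt Φ' (Φ'' σ) (Set.Icc 0 1) σ)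
    (hΦ''cont : ContinuousOn Φ'' (Set.Icc 0 1))
    (hspeed : ∀ σ ∈ Set.Icc (0:ℝ) 1, ‖Φ' σ‖ = L)
    (hτ0 : Φ' 0 = L • vec2 (Real.cos α) (Real.sin α))
    (hcurv : ∀ σ ∈ Set.Icc (0:ℝ) 1, ‖Φ'' σ‖ ≤ K * L ^ 2)
    (f f' : ℝ → EuclideanSpace ℝ (Fin 2))
    (hf' : ∀ σ ∈ Set.Icc (0:ℝ) 1, HasDerivWithinAt f (f' σ) (Set.Icc 0 1) σ)
    (hf'cont : ContinuousOn f' (Set.Icc 0 1))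
    (hf0 : f 0 1 = 0)
    (hclose : ∀ σ ∈ Set.Icc (0:ℝ) 1, ‖f' σ - Φ' σ‖ ≤ ξ₁) :
    ∀ σ ∈ Set.Ioc (0:ℝ) 1, σ < 2 * (L * Real.sin α - ξ₁) / (K * L ^ 2) →
      0 < f σ 1 := by
  intro σ hσ hσz
  have hΦ₂ : ∀ t ∈ Set.Icc (0:ℝ) 1, L * Real.sin α - K * L ^ 2 * t ≤ Φ' t 1 := by
    refine image_le_of_hasDerivWithinAt_Icc_le (u' := fun _ => -(K * L ^ 2))
      (v' := fun t => Φ'' t 1) (fun t _ => ?_)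
      (fun t ht => EuclideanSpace.hasDerivWithinAt_apply (hΦ'' t ht) 1) (fun t ht => ?_) ?_
    · simpa using (((hasDerivAt_id t).const_mul (K * L ^ 2)).const_sub
        (L * Real.sin α)).hasDerivWithinAt
    · exact (abs_le.1 ((PiLp.norm_apply_le (Φ'' t) 1).trans (hcurv t ht))).1
    · simp [hτ0, vec2]
  have hf₂ : ∀ t ∈ Set.Icc (0:ℝ) 1,
      (L * Real.sin α - ξ₁) * t - K * L ^ 2 / 2 * t ^ 2 ≤ f t 1 := by
    refine image_le_of_hasDerivWithinAt_Icc_le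
      (u' := fun t => (L * Real.sin α - ξ₁) - K * L ^ 2 * t)
      (v' := fun t => f' t 1) (fun t _ => ?_)
      (fun t ht => EuclideanSpace.hasDerivWithinAt_apply (hf' t ht) 1) (fun t ht => ?_) ?_
    · have h := (((hasDerivAt_id t).const_mul (L * Real.sin α - ξ₁)).sub
        ((hasDerivAt_pow 2 t).const_mul (K * L ^ 2 / 2))).hasDerivWithinAt (s := Set.Icc 0 1)
      refine h.congr_deriv ?_
      push_cast
      ring
    · have h : -ξ₁ ≤ f' t 1 - Φ' t 1 :=
        (abs_le.1 ((PiLp.norm_apply_le (f' t - Φ' t) 1).trans (hclose t ht))).1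
      have := hΦ₂ t ht
      linarith
    · simp [hf0]
  refine lt_of_lt_of_le ?_ (hf₂ σ ⟨hσ.1.le, hσ.2⟩)
  rw [lt_div_iff₀ (by positivity)] at hσz
  have := mul_pos hσ.1 (sub_pos.2 hσz)
  linarith
end
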